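/- (Theorem, converse direction: the additional Serre relations (22c), (22f) follow from relations (38).) Assume moreover n ≥ 1 and m ≥ 2 (so that 1 ≤ n and n+2 ≤ N). Then e_{n+1}·Y + Y·e_{n+1} = 0 for Y = [[e_n,e_{n+1}]_{q̄}, e_{n+2}]_q and for Y = [[e_n,e_{n+1}]_q, e_{n+2}]_{q̄}, and likewise f_{n+1}·Z + Z·f_{n+1} = 0 for Z = [[f_n,f_{n+1}]_{q̄}, f_{n+2}]_q and for Z = [[f_n,f_{n+1}]_q, f_{n+2}]_{q̄}. -/

import Mathlib

/-- The grading index: `θ i = 0` if `i ≤ n`, `θ i = 1` if `i > n`. -/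
def thetaIdx (n i : ℕ) : ℕ := if i ≤ n then 0 else 1

/-- `p_i = θ_{i−1} + θ_i`. -/
def pIdx (n i : ℕ) : ℕ := thetaIdx n (i - 1) + thetaIdx n i

/-- The distinguished Cartan matrix of `sl(n+1|m)`:
`α_{ij} = (1+(−1)^{p_i})δ_{ij} − (−1)^{p_i}δ_{i,j−1} − δ_{i−1,j}`. -/
def alphaMat (n i j : ℕ) : ℤ :=
  (1 + (-1) ^ pIdx n i) * (if i = j then 1 else 0)
    - (-1) ^ pIdx n i * (if i + 1 = j then 1 else 0)
    - (if i = j + 1 then 1 else 0)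

/-- The `x`-deformed commutator `[u,v]_x = uv − x·vu`. -/
def cmx {K A : Type*} [Field K] [Ring A] [Algebra K A] (x : K) (u v : A) : A :=
  u * v - x • (v * u)

/-- Both additional Serre relations for `a, b, c`. -/
def SerrePair {K A : Type*} [Field K] [Ring A] [Algebra K A] (q : K) (a b c : A) : Prop :=
  (b * cmx q (cmx q⁻¹ a b) c + cmx q (cmx q⁻¹ a b) c * b = 0) ∧
  (b * cmx q⁻¹ (cmx q a b) c + cmx q⁻¹ (cmx q a b) c * b = 0)

lemma serrePair_of {K A : Type*} [Field K] [Ring A] [Algebra K A] (q : K) (hq : q ≠ 0)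
    (X X1 X2 b c : A)
    (h1 : b * X = q • (X * b) - q • X1)
    (h2 : b * X1 = -(q • (X1 * b)))
    (h3 : c * X1 = q⁻¹ • (X1 * c) - q⁻¹ • X2)
    (h4 : c * X = X * c)
    (h5 : b * X2 = -(X2 * b))
    (h6 : (1 + q ^ 2) • (b * b) = 0)
    (h7 : b * b * c = q ^ 2 • (c * (b * b))) : SerrePair q X b c := by
  have e1 : cmx q⁻¹ X b = X1 := by
    unfold cmx; rw [h1, smul_sub, smul_smul, smul_smul, inv_mul_cancel₀ hq]; simp
  have e2 : cmx q X1 c = X2 := by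
    unfold cmx; rw [h3, smul_sub, smul_smul, smul_smul, mul_inv_cancel₀ hq]; simp
  have hY1 : b * cmx q (cmx q⁻¹ X b) c + cmx q (cmx q⁻¹ X b) c * b = 0 := by
    rw [e1, e2, h5]; simp
  refine ⟨hY1, ?_⟩
  have hbX : b * b * X = q ^ 2 • (X * (b * b)) := by
    rw [mul_assoc, h1, mul_sub, mul_smul_comm, mul_smul_comm, ← mul_assoc, h1, h2]
    simp only [sub_mul, smul_mul_assoc, mul_assoc]
    module
  have hcomm : b * b * (X * c) = X * c * (b * b) := by
    rw [← mul_assoc, hbX, smul_mul_assoc, mul_assoc X, h7, mul_smul_comm, smul_smul]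
    have : (q ^ 2 * q ^ 2) • (b * b) = b * b := by
      have h : (q ^ 2 * q ^ 2) • (b * b) = (q ^ 2 - 1) • ((1 + q ^ 2) • (b * b)) + b * b := by
        module
      rw [h, h6]; simp
    rw [← mul_assoc X, ← mul_smul_comm, this]
  have key : b * cmx q⁻¹ (cmx q X b) c + cmx q⁻¹ (cmx q X b) c * b
      = (b * cmx q (cmx q⁻¹ X b) c + cmx q (cmx q⁻¹ X b) c * b)
        + (q⁻¹ - q) • (b * b * (X * c) - X * c * (b * b)) := by
    have h4' : ∀ z, c * (X * z) = X * (c * z) := fun z => by rw [← mul_assoc, h4, mul_assoc]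
    unfold cmx
    simp only [mul_sub, sub_mul, smul_mul_assoc, mul_smul_comm, mul_assoc, smul_sub, smul_smul,
      h4', mul_inv_cancel₀ hq, inv_mul_cancel₀ hq, one_smul]
    module
  rw [key, hY1, hcomm]; simp

lemma serrePair_lift {K A : Type*} [Field K] [Ring A] [Algebra K A] (q : K)
    (X R l b c : A) (h : SerrePair q X b c)
    (hbR : b * R = R * b) (hcR : c * R = R * c) (hbl : b * l = l * b) (hcl : c * l = l * c) :
    SerrePair q (-((X * R - R * X) * l)) b c := by
  have hbR' : ∀ z, b * (R * z) = R * (b * z) := fun z => by rw [← mul_assoc, hbR, mul_assoc]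
  have hcR' : ∀ z, c * (R * z) = R * (c * z) := fun z => by rw [← mul_assoc, hcR, mul_assoc]
  have key : ∀ s t : K, b * cmx s (cmx t (-((X * R - R * X) * l)) b) c
        + cmx s (cmx t (-((X * R - R * X) * l)) b) c * b
      = -(((b * cmx s (cmx t X b) c + cmx s (cmx t X b) c * b) * R
          - R * (b * cmx s (cmx t X b) c + cmx s (cmx t X b) c * b)) * l) := by
    intro s t
    unfold cmx
    simp only [mul_sub, sub_mul, mul_add, add_mul, neg_mul, mul_neg, smul_mul_assoc,
      mul_smul_comm, mul_assoc, smul_sub, smul_neg, smul_smul, hbR, hcR, hbR', hcR', ← hbl, ← hcl]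
    module
  exact ⟨by rw [key, h.1]; simp, by rw [key, h.2]; simp⟩

lemma core_rel {K A : Type*} [Field K] [Ring A] [Algebra K A] (q : K) (hq : q ≠ 0)
    (X X1 X2 P P1 L L1 Lb Lb1 D E b c : A)
    (hD : D = X1 * P - P * X1) (hE : E = X2 * P1 + P1 * X2)
    (hb : b = -(D * L)) (hc : c = E * L1)
    (hLL : Lb * L = 1) (hL1 : Lb1 * L1 = 1) (hL1' : L1 * Lb1 = 1) (hLL1 : L * L1 = L1 * L)
    (LX : L * X = q ^ 2 • (X * L)) (LX1 : L * X1 = q • (X1 * L)) (LX2 : L * X2 = q • (X2 * L))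
    (LP : L * P = (q⁻¹) ^ 2 • (P * L)) (LP1 : L * P1 = q⁻¹ • (P1 * L))
    (MX : L1 * X = q • (X * L1)) (MX1 : L1 * X1 = X1 * L1) (MX2 : L1 * X2 = q • (X2 * L1))
    (MP : L1 * P = q⁻¹ • (P * L1))
    (DX : D * X = q⁻¹ • (X * D) + Lb * X1) (DX1 : D * X1 = -(X1 * D))
    (DX2 : D * X2 = -(q⁻¹ • (X2 * D))) (DP : D * P = q ^ 2 • (P * D))
    (DP1 : D * P1 = -(q • (P1 * D)) - Lb1 * P)
    (EX : E * X = q⁻¹ • (X * E)) (EX1 : E * X1 = q⁻¹ • (X1 * E) - Lb1 * X2) :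
    SerrePair q X b c := by
  have hX1L : X1 * L = q⁻¹ • (L * X1) := by
    rw [LX1, smul_smul, inv_mul_cancel₀ hq, one_smul]
  have hX2M : X2 * L1 = q⁻¹ • (L1 * X2) := by
    rw [MX2, smul_smul, inv_mul_cancel₀ hq, one_smul]
  have LD : L * D = q⁻¹ • (D * L) := by
    have LX1' : ∀ z, L * (X1 * z) = q • (X1 * (L * z)) := fun z => by
      rw [← mul_assoc, LX1, smul_mul_assoc, mul_assoc]
    have LP' : ∀ z, L * (P * z) = (q⁻¹) ^ 2 • (P * (L * z)) := fun z => by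
      rw [← mul_assoc, LP, smul_mul_assoc, mul_assoc]
    rw [hD]
    simp only [mul_sub, sub_mul, mul_assoc, LX1', LP', LX1, LP, mul_smul_comm, smul_sub, smul_smul]
    have : q * q⁻¹ ^ 2 = q⁻¹ := by field_simp
    have h' : q⁻¹ ^ 2 * q = q⁻¹ := by field_simp
    rw [this, h']
  have MD : L1 * D = q⁻¹ • (D * L1) := by
    have MX1' : ∀ z, L1 * (X1 * z) = (X1 * (L1 * z)) := fun z => by
      rw [← mul_assoc, MX1, mul_assoc]
    have MP' : ∀ z, L1 * (P * z) = (q⁻¹) • (P * (L1 * z)) := fun z => by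
      rw [← mul_assoc, MP, smul_mul_assoc, mul_assoc]
    rw [hD]
    simp only [mul_sub, sub_mul, mul_assoc, MX1', MP', MX1, MP, mul_smul_comm, smul_sub, smul_smul]
  have bM : b * L1 = q • (L1 * b) := by
    rw [hb, mul_neg, ← mul_assoc, MD, neg_mul, mul_assoc, hLL1]
    simp [mul_assoc, smul_smul, mul_inv_cancel₀ hq]
  have bMb : b * Lb1 = q⁻¹ • (Lb1 * b) := by
    have : Lb1 * (b * L1) * Lb1 = Lb1 * (q • (L1 * b)) * Lb1 := by rw [bM]
    have h2 : Lb1 * (b * L1) * Lb1 = Lb1 * b := by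
      rw [← mul_assoc, mul_assoc, hL1', mul_one]
    have h3 : Lb1 * (q • (L1 * b)) * Lb1 = q • (b * Lb1) := by
      rw [mul_smul_comm, ← mul_assoc, hL1, one_mul, smul_mul_assoc]
    rw [h2, h3] at this
    rw [this, smul_smul, inv_mul_cancel₀ hq, one_smul]
  have bL : b * L = q • (L * b) := by
    rw [hb, mul_neg, ← mul_assoc, LD, neg_mul]
    simp [mul_assoc, smul_smul, mul_inv_cancel₀ hq]
  -- general transfer from D to b
  have h1 : b * X = q • (X * b) - q • X1 := by
    rw [hb, neg_mul, mul_assoc, LX, mul_smul_comm, ← mul_assoc, DX, add_mul, mul_assoc Lb, hX1L,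
      mul_smul_comm, ← mul_assoc Lb, hLL, one_mul, smul_mul_assoc, smul_add, smul_smul, smul_smul,
      mul_assoc, mul_neg]
    have : q ^ 2 * q⁻¹ = q := by field_simp
    rw [this]; module
  have h2 : b * X1 = -(q • (X1 * b)) := by
    rw [hb, neg_mul, mul_assoc, LX1, mul_smul_comm, ← mul_assoc, DX1]
    simp [mul_assoc]
  have h5 : b * X2 = -(X2 * b) := by
    rw [hb, neg_mul, mul_assoc, LX2, mul_smul_comm, ← mul_assoc, DX2]
    simp [mul_assoc, smul_smul, mul_inv_cancel₀ hq]
  have bP : b * P = P * b := by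
    rw [hb, neg_mul, mul_assoc, LP, mul_smul_comm, ← mul_assoc, DP]
    simp [mul_assoc, smul_smul, hq]
  have bP1 : b * P1 = -(P1 * b) + q⁻¹ • (Lb1 * (P * L)) := by
    rw [hb, neg_mul, mul_assoc, LP1, mul_smul_comm, ← mul_assoc, DP1]
    simp only [sub_mul, neg_mul, smul_mul_assoc, mul_neg, smul_sub, smul_neg, smul_smul,
      mul_assoc, inv_mul_cancel₀ hq, one_smul]
    module
  have h3 : c * X1 = q⁻¹ • (X1 * c) - q⁻¹ • X2 := by
    rw [hc, mul_assoc, MX1, ← mul_assoc, EX1, sub_mul, mul_assoc Lb1, hX2M, mul_smul_comm,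
      ← mul_assoc Lb1, hL1, one_mul, smul_mul_assoc, mul_assoc]
  have h4 : c * X = X * c := by
    rw [hc, mul_assoc, MX, mul_smul_comm, ← mul_assoc, EX]
    simp [mul_assoc, smul_smul, mul_inv_cancel₀ hq]
  have hDD : (1 + q ^ 2) • (D * D) = 0 := by
    have : D * D = -(q ^ 2 • (D * D)) := by
      have DX1' : ∀ z, D * (X1 * z) = -(X1 * (D * z)) := fun z => by
        rw [← mul_assoc, DX1, neg_mul, mul_assoc]
      have DP' : ∀ z, D * (P * z) = q ^ 2 • (P * (D * z)) := fun z => by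
        rw [← mul_assoc, DP, smul_mul_assoc, mul_assoc]
      have s1 : D * (X1 * P - P * X1) = -(q ^ 2 • ((X1 * P - P * X1) * D)) := by
        simp only [mul_sub, sub_mul, DX1', DP', DX1, DP, mul_assoc, mul_smul_comm, mul_neg]
        module
      rw [← hD] at s1; exact s1
    rw [add_smul, one_smul]
    nth_rewrite 1 [this]; simp
  have h6 : (1 + q ^ 2) • (b * b) = 0 := by
    have : b * b = q⁻¹ • (D * D * (L * L)) := by
      rw [hb, neg_mul_neg, mul_assoc, ← mul_assoc L, LD]
      simp [mul_assoc]
    rw [this, smul_comm, ← smul_mul_assoc, hDD]; simp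
  have h7 : b * b * c = q ^ 2 • (c * (b * b)) := by
    have bX2' : ∀ z, b * (X2 * z) = -(X2 * (b * z)) := fun z => by
      rw [← mul_assoc, h5, neg_mul, mul_assoc]
    have bw : b * (Lb1 * (P * L)) = Lb1 * (P * L) * b := by
      rw [← mul_assoc, bMb, smul_mul_assoc, mul_assoc, ← mul_assoc b, bP, mul_assoc P, bL]
      simp [mul_assoc, smul_smul, inv_mul_cancel₀ hq]
    have bbP1 : b * (b * P1) = P1 * (b * b) := by
      rw [bP1, mul_add, mul_neg, ← mul_assoc, bP1, mul_smul_comm, bw, add_mul]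
      simp [mul_assoc]
    have bbP1' : ∀ z, b * (b * (P1 * z)) = P1 * (b * (b * z)) := fun z => by
      have := congrArg (· * z) bbP1
      simpa [mul_assoc] using this
    have bM' : b * (b * L1) = q ^ 2 • (L1 * (b * b)) := by
      rw [bM, mul_smul_comm, ← mul_assoc, bM, smul_mul_assoc, smul_smul, mul_assoc, sq]
    rw [hc, hE]
    simp only [add_mul, mul_add, mul_assoc, bX2', mul_neg, bbP1', bM', mul_smul_comm, neg_neg,
      smul_add]
  exact serrePair_of q hq X X1 X2 b c h1 h2 h3 h4 h5 h6 h7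

lemma core_rel_lift {K A : Type*} [Field K] [Ring A] [Algebra K A] (q : K) (hq : q ≠ 0)
    (X X1 X2 P P1 L L1 D E R l b c : A)
    (hD : D = X1 * P - P * X1) (hE : E = X2 * P1 + P1 * X2)
    (hb : b = -(D * L)) (hc : c = E * L1) (hS : SerrePair q X b c)
    (LR : L * R = q⁻¹ • (R * L)) (MR : L1 * R = q⁻¹ • (R * L1))
    (DR : D * R = q • (R * D)) (ER : E * R = q • (R * E))
    (lL : l * L = L * l) (lL1 : l * L1 = L1 * l)
    (lX1 : l * X1 = q • (X1 * l)) (lX2 : l * X2 = q • (X2 * l))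
    (lP : l * P = q⁻¹ • (P * l)) (lP1 : l * P1 = q⁻¹ • (P1 * l)) :
    SerrePair q (-((X * R - R * X) * l)) b c := by
  have lX1' : ∀ z, l * (X1 * z) = q • (X1 * (l * z)) := fun z => by
    rw [← mul_assoc, lX1, smul_mul_assoc, mul_assoc]
  have lX2' : ∀ z, l * (X2 * z) = q • (X2 * (l * z)) := fun z => by
    rw [← mul_assoc, lX2, smul_mul_assoc, mul_assoc]
  have lP' : ∀ z, l * (P * z) = q⁻¹ • (P * (l * z)) := fun z => by
    rw [← mul_assoc, lP, smul_mul_assoc, mul_assoc]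
  have lP1' : ∀ z, l * (P1 * z) = q⁻¹ • (P1 * (l * z)) := fun z => by
    rw [← mul_assoc, lP1, smul_mul_assoc, mul_assoc]
  refine serrePair_lift q X R l b c hS ?_ ?_ ?_ ?_
  · rw [hb, neg_mul, mul_assoc, LR, mul_smul_comm, ← mul_assoc, DR]
    simp [mul_assoc, smul_smul, inv_mul_cancel₀ hq]
  · rw [hc, mul_assoc, MR, mul_smul_comm, ← mul_assoc, ER]
    simp [mul_assoc, smul_smul, inv_mul_cancel₀ hq]
  · rw [hb, hD]
    simp only [mul_neg, neg_mul, mul_sub, sub_mul, mul_assoc, lX1', lP', ← lL, mul_smul_comm,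
      smul_smul, mul_inv_cancel₀ hq, inv_mul_cancel₀ hq, one_smul]
  · rw [hc, hE]
    simp only [mul_add, add_mul, mul_assoc, lX2', lP1', ← lL1, mul_smul_comm,
      smul_smul, mul_inv_cancel₀ hq, inv_mul_cancel₀ hq, one_smul]


lemma swap_inv {K A : Type*} [Field K] [Ring A] [Algebra K A] (s : K) (L Lb a : A)
    (h1 : L * Lb = 1) (h2 : Lb * L = 1) (h : L * a = s • (a * L)) :
    a * Lb = s • (Lb * a) := by
  have : Lb * (L * a) * Lb = Lb * (s • (a * L)) * Lb := by rw [h]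
  rw [← mul_assoc, h2, one_mul] at this
  rw [this, mul_smul_comm, smul_mul_assoc, mul_assoc, mul_assoc, h1, mul_one]

lemma serrePair_op {K A : Type*} [Field K] [Ring A] [Algebra K A] (q : K) (hq : q ≠ 0) (a b c : A)
    (h : SerrePair q⁻¹ (MulOpposite.op a) (MulOpposite.op b) (MulOpposite.op c)) :
    SerrePair q a b c := by
  have key : ∀ s t : K, s * t = 1 → MulOpposite.op (b * cmx s (cmx t a b) c + cmx s (cmx t a b) c * b)
      = MulOpposite.op b * cmx t (cmx s (MulOpposite.op a) (MulOpposite.op b)) (MulOpposite.op c)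
        + cmx t (cmx s (MulOpposite.op a) (MulOpposite.op b)) (MulOpposite.op c)
          * MulOpposite.op b := by
    intro s t hst
    have hts : t * s = 1 := by rw [mul_comm, hst]
    unfold cmx
    simp only [← MulOpposite.op_mul, ← MulOpposite.op_smul, ← MulOpposite.op_sub,
      ← MulOpposite.op_add]
    congr 1
    simp only [mul_sub, sub_mul, smul_mul_assoc, mul_smul_comm, mul_assoc, smul_sub, smul_smul,
      hst, hts, one_smul]
    module
  unfold SerrePair at h
  rw [inv_inv] at h
  refine ⟨MulOpposite.op_injective ?_, MulOpposite.op_injective ?_⟩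
  · rw [key _ _ (mul_inv_cancel₀ hq)]; exact h.1
  · rw [key _ _ (inv_mul_cancel₀ hq)]; exact h.2

lemma swap_tri {K A : Type*} [Field K] [Ring A] [Algebra K A] (s : K) (hs : s ≠ 0) (u a w : A)
    (h : u * a - s • (a * u) = w) : a * u = s⁻¹ • (u * a) - s⁻¹ • w := by
  rw [← h, smul_sub, smul_smul, inv_mul_cancel₀ hs]; simp

/-- Theorem, converse direction: the additional Serre relations (22c), (22f)
follow from the relations (38) (assuming `n ≥ 1` and `m ≥ 2`). -/
theorem stmt19
    (K : Type*) (A : Type*) [Field K] [Ring A] [Algebra K A]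
    (n m : ℕ) (hm : 1 ≤ m)
    (q : K) (hq0 : q ≠ 0) (hq1 : q ^ 2 ≠ 1)
    (aP aM L Lb : ℕ → A)
    -- L_i L̄_i = L̄_i L_i = 1
    (hLinv : ∀ i, 1 ≤ i → i ≤ n + m → L i * Lb i = 1 ∧ Lb i * L i = 1)
    -- all L_i, L̄_j commute with one another
    (hLcomm : ∀ i j, 1 ≤ i → i ≤ n + m → 1 ≤ j → j ≤ n + m →
      L i * L j = L j * L i ∧ L i * Lb j = Lb j * L i ∧ Lb i * Lb j = Lb j * Lb i)
    -- L_i a_j^- = q^{1+(−1)^{θ_i}δ_{ij}} a_j^- L_i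
    (hLaM : ∀ i j, 1 ≤ i → i ≤ n + m → 1 ≤ j → j ≤ n + m →
      L i * aM j
        = (q ^ ((1 : ℤ) + (-1 : ℤ) ^ thetaIdx n i * (if i = j then 1 else 0))) •
            (aM j * L i))
    -- L_i a_j^+ = q^{−(1+(−1)^{θ_i}δ_{ij})} a_j^+ L_i
    (hLaP : ∀ i j, 1 ≤ i → i ≤ n + m → 1 ≤ j → j ≤ n + m →
      L i * aP j
        = (q ^ (-((1 : ℤ) + (-1 : ℤ) ^ thetaIdx n i * (if i = j then 1 else 0)))) •
            (aP j * L i))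
    -- (38c)
    (h38c : ∀ i, 1 ≤ i → i ≤ n + m →
      aM i * aP i - ((-1 : K) ^ thetaIdx n i) • (aP i * aM i)
        = (q - q⁻¹)⁻¹ • (L i - Lb i))
    -- the encoding aa 1 = a^+, aa (-1) = a^-
    (aa : ℤ → ℕ → A) (haaP : ∀ j, aa 1 j = aP j) (haaM : ∀ j, aa (-1) j = aM j)
    -- (38d): the triple relations
    (h38d : ∀ ξ η : ℤ, (ξ = 1 ∨ ξ = -1) → (η = 1 ∨ η = -1) →
      ∀ i k : ℕ, 1 ≤ i → 1 ≤ (i : ℤ) + ξ → (i : ℤ) + ξ ≤ (n + m : ℤ) →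
        1 ≤ k → k ≤ n + m →
        (aa η i * aa (-η) ((i : ℤ) + ξ).toNat
            - ((-1 : K) ^ (thetaIdx n i * thetaIdx n ((i : ℤ) + ξ).toNat)) •
                (aa (-η) ((i : ℤ) + ξ).toNat * aa η i)) * aa η k
          - (((-1 : K) ^ ((thetaIdx n i + thetaIdx n ((i : ℤ) + ξ).toNat) * thetaIdx n k))
              * q ^ (ξ * (1 + (-1 : ℤ) ^ thetaIdx n i * (if i = k then 1 else 0)))) •
              (aa η k *
                (aa η i * aa (-η) ((i : ℤ) + ξ).toNat
                  - ((-1 : K) ^ (thetaIdx n i * thetaIdx n ((i : ℤ) + ξ).toNat)) •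
                      (aa (-η) ((i : ℤ) + ξ).toNat * aa η i)))
        = ((if thetaIdx n k = 0 then (1 : K) else (η : K))
              * (if (k : ℤ) = (i : ℤ) + ξ then 1 else 0)) •
            ((if ξ * η = 1 then Lb k else L k) * aa η i))
    -- (38e)
    (h38e : 2 ≤ n + m →
      aP 1 * aP 2 - (((-1 : K) ^ (thetaIdx n 1 * thetaIdx n 2)) * q) • (aP 2 * aP 1) = 0 ∧
      aM 1 * aM 2 - (((-1 : K) ^ (thetaIdx n 1 * thetaIdx n 2)) * q) • (aM 2 * aM 1) = 0)
    (h38e1 : n = 0 → aP 1 * aP 1 = 0 ∧ aM 1 * aM 1 = 0)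
    -- the Chevalley generators, defined from the CAGs
    (e f : ℕ → A)
    (he1 : e 1 = aM 1) (hf1 : f 1 = aP 1)
    (he : ∀ i, 1 ≤ i → i + 1 ≤ n + m →
      e (i + 1) = -(((-1 : K) ^ thetaIdx n i) •
          ((aM (i + 1) * aP i
              - ((-1 : K) ^ (thetaIdx n i * thetaIdx n (i + 1))) • (aP i * aM (i + 1)))
            * L i)))
    (hf : ∀ i, 1 ≤ i → i + 1 ≤ n + m →
      f (i + 1) = -(((-1 : K) ^ thetaIdx n i) •
          (Lb i * (aM i * aP (i + 1)
              - ((-1 : K) ^ (thetaIdx n i * thetaIdx n (i + 1))) • (aP (i + 1) * aM i)))))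
    (hn : 1 ≤ n) (hm2 : 2 ≤ m)
    :
    (e (n + 1) * cmx q (cmx q⁻¹ (e n) (e (n + 1))) (e (n + 2))
        + cmx q (cmx q⁻¹ (e n) (e (n + 1))) (e (n + 2)) * e (n + 1) = 0) ∧
    (e (n + 1) * cmx q⁻¹ (cmx q (e n) (e (n + 1))) (e (n + 2))
        + cmx q⁻¹ (cmx q (e n) (e (n + 1))) (e (n + 2)) * e (n + 1) = 0) ∧
    (f (n + 1) * cmx q (cmx q⁻¹ (f n) (f (n + 1))) (f (n + 2))
        + cmx q (cmx q⁻¹ (f n) (f (n + 1))) (f (n + 2)) * f (n + 1) = 0) ∧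
    (f (n + 1) * cmx q⁻¹ (cmx q (f n) (f (n + 1))) (f (n + 2))
        + cmx q⁻¹ (cmx q (f n) (f (n + 1))) (f (n + 2)) * f (n + 1) = 0) := by
  
  obtain ⟨r, rfl⟩ : ∃ r, n = r + 1 := ⟨n - 1, by omega⟩
  -- the L–a commutation rules
  have LM_ne : ∀ i j, 1 ≤ i → i ≤ r + 1 + m → 1 ≤ j → j ≤ r + 1 + m → i ≠ j →
      L i * aM j = q • (aM j * L i) := by
    intro i j h1 h2 h3 h4 hij
    simpa [hij] using hLaM i j h1 h2 h3 h4
  have LP_ne : ∀ i j, 1 ≤ i → i ≤ r + 1 + m → 1 ≤ j → j ≤ r + 1 + m → i ≠ j →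
      L i * aP j = q⁻¹ • (aP j * L i) := by
    intro i j h1 h2 h3 h4 hij
    simpa [hij] using hLaP i j h1 h2 h3 h4
  have t0 : thetaIdx (r + 1) r = 0 := by simp [thetaIdx]
  have t1 : thetaIdx (r + 1) (r + 1) = 0 := by simp [thetaIdx]
  have t2 : thetaIdx (r + 1) (r + 2) = 1 := by simp [thetaIdx]
  have t3 : thetaIdx (r + 1) (r + 3) = 1 := by simp [thetaIdx]
  have LM_0 : L (r + 1) * aM (r + 1) = q ^ 2 • (aM (r + 1) * L (r + 1)) := by
    have h := hLaM (r + 1) (r + 1) (by omega) (by omega) (by omega) (by omega)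
    rw [t1] at h
    rw [h, show (1 : ℤ) + (-1) ^ 0 * (if r + 1 = r + 1 then 1 else 0) = (2 : ℕ) by simp,
      zpow_natCast]
  have LP_0 : L (r + 1) * aP (r + 1) = (q⁻¹) ^ 2 • (aP (r + 1) * L (r + 1)) := by
    have h := hLaP (r + 1) (r + 1) (by omega) (by omega) (by omega) (by omega)
    rw [t1] at h
    rw [h, show (1 : ℤ) + (-1) ^ 0 * (if r + 1 = r + 1 then 1 else 0) = (2 : ℕ) by simp,
      zpow_neg, zpow_natCast, inv_pow]
  have LM_1 : L (r + 2) * aM (r + 2) = aM (r + 2) * L (r + 2) := by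
    simpa [t2] using hLaM (r + 2) (r + 2) (by omega) (by omega) (by omega) (by omega)
  have LP_1 : L (r + 2) * aP (r + 2) = aP (r + 2) * L (r + 2) := by
    simpa [t2] using hLaP (r + 2) (r + 2) (by omega) (by omega) (by omega) (by omega)
  -- the two directions of the triple relations
  have up := fun (η : ℤ) (hη : η = 1 ∨ η = -1) (i k : ℕ) (hi : 1 ≤ i) (hi' : i + 1 ≤ r + 1 + m)
    (hk : 1 ≤ k) (hk' : k ≤ r + 1 + m) =>
      h38d 1 η (Or.inl rfl) hη i k hi (by omega) (by push_cast; omega) hk hk'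
  have down := fun (η : ℤ) (hη : η = 1 ∨ η = -1) (i k : ℕ) (hi : 1 ≤ i) (hi' : i + 1 ≤ r + 1 + m)
    (hk : 1 ≤ k) (hk' : k ≤ r + 1 + m) =>
      h38d (-1) η (Or.inr rfl) hη (i + 1) k (by omega) (by push_cast; omega)
        (by push_cast; omega) hk hk'
  have tn : ∀ i : ℕ, ((i : ℤ) + 1).toNat = i + 1 := fun i => by omega
  have tn' : ∀ i : ℕ, (((i + 1 : ℕ) : ℤ) + -1).toNat = i := fun i => by omega
  simp only [tn] at up
  simp only [tn'] at down
  have upP := fun i => up 1 (Or.inl rfl) i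
  have upM := fun i => up (-1) (Or.inr rfl) i
  have dnP := fun i => down 1 (Or.inl rfl) i
  have dnM := fun i => down (-1) (Or.inr rfl) i
  simp only [haaP, haaM, neg_neg] at upP upM dnP dnM
  clear up down h38d
  have two : ((1 : ℤ) + 1) = 2 := by norm_num
  have z2 : q ^ (2 : ℤ) = q ^ 2 := by norm_cast
  -- E-side relations
  have A1 := dnM (r + 1) (r + 1) (by omega) (by omega) (by omega) (by omega)
  have A2 := dnM (r + 1) (r + 2) (by omega) (by omega) (by omega) (by omega)
  have A3 := dnM (r + 1) (r + 3) (by omega) (by omega) (by omega) (by omega)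
  have A4 := upP (r + 1) (r + 1) (by omega) (by omega) (by omega) (by omega)
  have A5 := upP (r + 1) (r + 2) (by omega) (by omega) (by omega) (by omega)
  have A6 := dnM (r + 2) (r + 1) (by omega) (by omega) (by omega) (by omega)
  have A7 := dnM (r + 2) (r + 2) (by omega) (by omega) (by omega) (by omega)
  have B1 := dnP (r + 1) (r + 1) (by omega) (by omega) (by omega) (by omega)
  have B2 := dnP (r + 1) (r + 2) (by omega) (by omega) (by omega) (by omega)
  have B3 := dnP (r + 1) (r + 3) (by omega) (by omega) (by omega) (by omega)
  have B4 := upM (r + 1) (r + 1) (by omega) (by omega) (by omega) (by omega)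
  have B5 := upM (r + 1) (r + 2) (by omega) (by omega) (by omega) (by omega)
  have B6 := dnP (r + 2) (r + 1) (by omega) (by omega) (by omega) (by omega)
  have B7 := dnP (r + 2) (r + 2) (by omega) (by omega) (by omega) (by omega)
  simp [t1, t2, t3, two, z2, add_assoc] at A1 A2 A3 A4 A5 A6 A7 B1 B2 B3 B4 B5 B6 B7
  have he2 : e (r + 2) = -((aM (r + 2) * aP (r + 1) - aP (r + 1) * aM (r + 2)) * L (r + 1)) := by
    simpa [t1, t2, add_assoc] using he (r + 1) (by omega) (by omega)
  have he3 : e (r + 3) = (aM (r + 3) * aP (r + 2) + aP (r + 2) * aM (r + 3)) * L (r + 2) := by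
    simpa [t3, t2, add_assoc] using he (r + 2) (by omega) (by omega)
  have hf2 : f (r + 2) = -(Lb (r + 1) * (aM (r + 1) * aP (r + 2) - aP (r + 2) * aM (r + 1))) := by
    simpa [t1, t2, add_assoc] using hf (r + 1) (by omega) (by omega)
  have hf3 : f (r + 3) = Lb (r + 2) * (aM (r + 2) * aP (r + 3) + aP (r + 3) * aM (r + 2)) := by
    simpa [t3, t2, add_assoc] using hf (r + 2) (by omega) (by omega)
  have hE : SerrePair q (e (r + 1)) (e (r + 2)) (e (r + 3)) := by
    have hX : SerrePair q (aM (r + 1)) (e (r + 2)) (e (r + 3)) := by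
      refine core_rel q hq0 (aM (r + 1)) (aM (r + 2)) (aM (r + 3)) (aP (r + 1)) (aP (r + 2))
        (L (r + 1)) (L (r + 2)) (Lb (r + 1)) (Lb (r + 2)) _ _ _ _ rfl rfl he2 he3
        (hLinv _ (by omega) (by omega)).2 (hLinv _ (by omega) (by omega)).2
        (hLinv _ (by omega) (by omega)).1
        (hLcomm _ _ (by omega) (by omega) (by omega) (by omega)).1
        LM_0 (LM_ne _ _ (by omega) (by omega) (by omega) (by omega) (by omega))
        (LM_ne _ _ (by omega) (by omega) (by omega) (by omega) (by omega))
        LP_0 (LP_ne _ _ (by omega) (by omega) (by omega) (by omega) (by omega))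
        (LM_ne _ _ (by omega) (by omega) (by omega) (by omega) (by omega))
        LM_1 (LM_ne _ _ (by omega) (by omega) (by omega) (by omega) (by omega))
        (LP_ne _ _ (by omega) (by omega) (by omega) (by omega) (by omega))
        ?_ ?_ ?_ ?_ ?_ ?_ ?_
      · rw [← A1]; abel
      · exact eq_neg_of_add_eq_zero_left A2
      · exact eq_neg_of_add_eq_zero_left A3
      · rw [← neg_sub (aP (r + 1) * aM (r + 2)), neg_mul, mul_neg, smul_neg, sub_eq_zero.mp A4]
      · rw [← A5, ← neg_sub (aP (r + 1) * aM (r + 2)), neg_mul, mul_neg, smul_neg]; abel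
      · exact sub_eq_zero.mp A6
      · rw [sub_eq_add_neg, ← A7]; abel
    rcases Nat.eq_zero_or_pos r with h0 | hr
    · subst h0
      rw [show (0 : ℕ) + 1 = 1 from rfl] at hX ⊢
      rw [he1]; exact hX
    have C1 := upP (r + 1) r (by omega) (by omega) (by omega) (by omega)
    have C2 := upP (r + 2) r (by omega) (by omega) (by omega) (by omega)
    simp [t0, t1, t2, t3, two, z2, add_assoc] at C1 C2
    have hea : e (r + 1) = -((aM (r + 1) * aP r - aP r * aM (r + 1)) * L r) := by
      simpa [t0, t1] using he r (by omega) (by omega)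
    rw [hea]
    refine core_rel_lift q hq0 (aM (r + 1)) (aM (r + 2)) (aM (r + 3)) (aP (r + 1)) (aP (r + 2))
        (L (r + 1)) (L (r + 2)) _ _ (aP r) (L r) _ _ rfl rfl he2 he3 hX
        (LP_ne _ _ (by omega) (by omega) (by omega) (by omega) (by omega))
        (LP_ne _ _ (by omega) (by omega) (by omega) (by omega) (by omega)) ?_ ?_
        (hLcomm _ _ (by omega) (by omega) (by omega) (by omega)).1
        (hLcomm _ _ (by omega) (by omega) (by omega) (by omega)).1
        (LM_ne _ _ (by omega) (by omega) (by omega) (by omega) (by omega))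
        (LM_ne _ _ (by omega) (by omega) (by omega) (by omega) (by omega))
        (LP_ne _ _ (by omega) (by omega) (by omega) (by omega) (by omega))
        (LP_ne _ _ (by omega) (by omega) (by omega) (by omega) (by omega))
    · rw [← neg_sub (aP (r + 1) * aM (r + 2)), neg_mul, mul_neg, smul_neg, sub_eq_zero.mp C1]
    · rw [add_comm (aM (r + 3) * aP (r + 2)), sub_eq_zero.mp C2]
  have hF : SerrePair q (f (r + 1)) (f (r + 2)) (f (r + 3)) := by
    have hqi : q⁻¹ ≠ 0 := inv_ne_zero hq0
    have LbM : ∀ i j, 1 ≤ i → i ≤ r + 1 + m → 1 ≤ j → j ≤ r + 1 + m → i ≠ j →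
        aM j * Lb i = (q⁻¹)⁻¹ • (Lb i * aM j) := by
      intro i j h1 h2 h3 h4 hij
      rw [inv_inv]
      exact swap_inv _ _ _ _ (hLinv i h1 h2).1 (hLinv i h1 h2).2 (LM_ne i j h1 h2 h3 h4 hij)
    have LbP : ∀ i j, 1 ≤ i → i ≤ r + 1 + m → 1 ≤ j → j ≤ r + 1 + m → i ≠ j →
        aP j * Lb i = q⁻¹ • (Lb i * aP j) := fun i j h1 h2 h3 h4 hij =>
      swap_inv _ _ _ _ (hLinv i h1 h2).1 (hLinv i h1 h2).2 (LP_ne i j h1 h2 h3 h4 hij)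
    have inv1 := hLinv (r + 1) (by omega) (by omega)
    have inv2 := hLinv (r + 2) (by omega) (by omega)
    have LbM0 : aM (r + 1) * Lb (r + 1) = ((q⁻¹)⁻¹) ^ 2 • (Lb (r + 1) * aM (r + 1)) := by
      rw [inv_inv]; exact swap_inv _ _ _ _ inv1.1 inv1.2 LM_0
    have LbP0 : aP (r + 1) * Lb (r + 1) = (q⁻¹) ^ 2 • (Lb (r + 1) * aP (r + 1)) :=
      swap_inv _ _ _ _ inv1.1 inv1.2 LP_0
    have LbP1 : aP (r + 2) * Lb (r + 2) = Lb (r + 2) * aP (r + 2) := by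
      have := swap_inv (1 : K) (L (r + 2)) (Lb (r + 2)) (aP (r + 2)) inv2.1 inv2.2
        (by rw [one_smul]; exact LP_1)
      rwa [one_smul] at this
    have LP21 := LP_ne (r + 1) (r + 2) (by omega) (by omega) (by omega) (by omega) (by omega)
    have LM12 := LM_ne (r + 2) (r + 1) (by omega) (by omega) (by omega) (by omega) (by omega)
    have LP32 := LP_ne (r + 2) (r + 3) (by omega) (by omega) (by omega) (by omega) (by omega)
    have hDn := neg_sub (aP (r + 2) * aM (r + 1)) (aM (r + 1) * aP (r + 2))
    have F1 : aP (r + 1) * (aM (r + 1) * aP (r + 2) - aP (r + 2) * aM (r + 1))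
        = (q⁻¹)⁻¹ • ((aM (r + 1) * aP (r + 2) - aP (r + 2) * aM (r + 1)) * aP (r + 1))
          + aP (r + 2) * L (r + 1) := by
      rw [← hDn, mul_neg, swap_tri _ hqi _ _ _ B1, LP21, smul_smul, inv_mul_cancel₀ hqi, neg_mul]
      module
    have F2 : aP (r + 2) * (aM (r + 1) * aP (r + 2) - aP (r + 2) * aM (r + 1))
        = -((aM (r + 1) * aP (r + 2) - aP (r + 2) * aM (r + 1)) * aP (r + 2)) := by
      rw [← hDn, mul_neg, neg_mul, eq_neg_of_add_eq_zero_left B2]; simp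
    have F3 : aP (r + 3) * (aM (r + 1) * aP (r + 2) - aP (r + 2) * aM (r + 1))
        = -((q⁻¹)⁻¹ • ((aM (r + 1) * aP (r + 2) - aP (r + 2) * aM (r + 1)) * aP (r + 3))) := by
      rw [← hDn, mul_neg, neg_mul, eq_neg_of_add_eq_zero_left B3, neg_neg, smul_smul,
        inv_mul_cancel₀ hqi, one_smul]
    have F4 : aM (r + 1) * (aM (r + 1) * aP (r + 2) - aP (r + 2) * aM (r + 1))
        = (q⁻¹) ^ 2 • ((aM (r + 1) * aP (r + 2) - aP (r + 2) * aM (r + 1)) * aM (r + 1)) := by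
      rw [sub_eq_zero.mp B4, smul_smul, inv_pow, inv_mul_cancel₀ (pow_ne_zero 2 hq0), one_smul]
    have F5 : aM (r + 2) * (aM (r + 1) * aP (r + 2) - aP (r + 2) * aM (r + 1))
        = -(q⁻¹ • ((aM (r + 1) * aP (r + 2) - aP (r + 2) * aM (r + 1)) * aM (r + 2)))
          - aM (r + 1) * L (r + 2) := by
      rw [eq_sub_of_add_eq B5, LM12, smul_sub, smul_neg, smul_smul, smul_smul,
        inv_mul_cancel₀ hq0]
      module
    have hEc := add_comm (aP (r + 3) * aM (r + 2)) (aM (r + 2) * aP (r + 3))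
    rw [hEc] at B6 B7
    have F6 : aP (r + 1) * (aM (r + 2) * aP (r + 3) + aP (r + 3) * aM (r + 2))
        = (q⁻¹)⁻¹ • ((aM (r + 2) * aP (r + 3) + aP (r + 3) * aM (r + 2)) * aP (r + 1)) := by
      rw [swap_tri _ hqi _ _ _ B6]; simp
    have F7 : aP (r + 2) * (aM (r + 2) * aP (r + 3) + aP (r + 3) * aM (r + 2))
        = (q⁻¹)⁻¹ • ((aM (r + 2) * aP (r + 3) + aP (r + 3) * aM (r + 2)) * aP (r + 2))
          - aP (r + 3) * L (r + 2) := by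
      rw [swap_tri _ hqi _ _ _ B7, LP32, smul_smul, inv_mul_cancel₀ hqi, one_smul]
    have gf2 := congrArg MulOpposite.op hf2
    have gf3 := congrArg MulOpposite.op hf3
    apply serrePair_op q hq0
    have hX : SerrePair q⁻¹ (MulOpposite.op (aP (r + 1))) (MulOpposite.op (f (r + 2)))
        (MulOpposite.op (f (r + 3))) :=
      core_rel q⁻¹ hqi (MulOpposite.op (aP (r + 1))) (MulOpposite.op (aP (r + 2)))
        (MulOpposite.op (aP (r + 3))) (MulOpposite.op (aM (r + 1))) (MulOpposite.op (aM (r + 2)))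
        (MulOpposite.op (Lb (r + 1))) (MulOpposite.op (Lb (r + 2)))
        (MulOpposite.op (L (r + 1))) (MulOpposite.op (L (r + 2)))
        (MulOpposite.op (aM (r + 1) * aP (r + 2) - aP (r + 2) * aM (r + 1)))
        (MulOpposite.op (aM (r + 2) * aP (r + 3) + aP (r + 3) * aM (r + 2))) _ _
        rfl rfl gf2 gf3
        (congrArg MulOpposite.op inv1.2) (congrArg MulOpposite.op inv2.2)
        (congrArg MulOpposite.op inv2.1)
        (congrArg MulOpposite.op (hLcomm (r + 2) (r + 1) (by omega) (by omega) (by omega)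
          (by omega)).2.2)
        (congrArg MulOpposite.op LbP0)
        (congrArg MulOpposite.op (LbP (r + 1) (r + 2) (by omega) (by omega) (by omega) (by omega)
          (by omega)))
        (congrArg MulOpposite.op (LbP (r + 1) (r + 3) (by omega) (by omega) (by omega) (by omega)
          (by omega)))
        (congrArg MulOpposite.op LbM0)
        (congrArg MulOpposite.op (LbM (r + 1) (r + 2) (by omega) (by omega) (by omega) (by omega)
          (by omega)))
        (congrArg MulOpposite.op (LbP (r + 2) (r + 1) (by omega) (by omega) (by omega) (by omega)
          (by omega)))
        (congrArg MulOpposite.op LbP1)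
        (congrArg MulOpposite.op (LbP (r + 2) (r + 3) (by omega) (by omega) (by omega) (by omega)
          (by omega)))
        (congrArg MulOpposite.op (LbM (r + 2) (r + 1) (by omega) (by omega) (by omega) (by omega)
          (by omega)))
        (congrArg MulOpposite.op F1) (congrArg MulOpposite.op F2) (congrArg MulOpposite.op F3)
        (congrArg MulOpposite.op F4) (congrArg MulOpposite.op F5) (congrArg MulOpposite.op F6)
        (congrArg MulOpposite.op F7)
    rcases Nat.eq_zero_or_pos r with h0 | hr
    · subst h0
      rw [show (0 : ℕ) + 1 = 1 from rfl] at hX ⊢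
      rw [hf1]; exact hX
    have C1 := upM (r + 1) r (by omega) (by omega) (by omega) (by omega)
    have C2 := upM (r + 2) r (by omega) (by omega) (by omega) (by omega)
    simp [t0, t1, t2, t3, two, z2, add_assoc] at C1 C2
    have G1 : aM r * (aM (r + 1) * aP (r + 2) - aP (r + 2) * aM (r + 1))
        = q⁻¹ • ((aM (r + 1) * aP (r + 2) - aP (r + 2) * aM (r + 1)) * aM r) := by
      rw [swap_tri _ hq0 _ _ _ C1]; simp
    have G2 : aM r * (aM (r + 2) * aP (r + 3) + aP (r + 3) * aM (r + 2))
        = q⁻¹ • ((aM (r + 2) * aP (r + 3) + aP (r + 3) * aM (r + 2)) * aM r) := by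
      rw [swap_tri _ hq0 _ _ _ C2]; simp
    have hfa : f (r + 1) = -(Lb r * (aM r * aP (r + 1) - aP (r + 1) * aM r)) := by
      simpa [t0, t1] using hf r (by omega) (by omega)
    rw [hfa]
    exact core_rel_lift q⁻¹ hqi (MulOpposite.op (aP (r + 1))) (MulOpposite.op (aP (r + 2)))
        (MulOpposite.op (aP (r + 3))) (MulOpposite.op (aM (r + 1))) (MulOpposite.op (aM (r + 2)))
        (MulOpposite.op (Lb (r + 1))) (MulOpposite.op (Lb (r + 2)))
        (MulOpposite.op (aM (r + 1) * aP (r + 2) - aP (r + 2) * aM (r + 1)))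
        (MulOpposite.op (aM (r + 2) * aP (r + 3) + aP (r + 3) * aM (r + 2)))
        (MulOpposite.op (aM r)) (MulOpposite.op (Lb r)) _ _
        rfl rfl gf2 gf3 hX
        (congrArg MulOpposite.op (LbM (r + 1) r (by omega) (by omega) (by omega) (by omega)
          (by omega)))
        (congrArg MulOpposite.op (LbM (r + 2) r (by omega) (by omega) (by omega) (by omega)
          (by omega)))
        (congrArg MulOpposite.op G1) (congrArg MulOpposite.op G2)
        (congrArg MulOpposite.op (hLcomm (r + 1) r (by omega) (by omega) (by omega)
          (by omega)).2.2)
        (congrArg MulOpposite.op (hLcomm (r + 2) r (by omega) (by omega) (by omega)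
          (by omega)).2.2)
        (congrArg MulOpposite.op (LbP r (r + 2) (by omega) (by omega) (by omega) (by omega)
          (by omega)))
        (congrArg MulOpposite.op (LbP r (r + 3) (by omega) (by omega) (by omega) (by omega)
          (by omega)))
        (congrArg MulOpposite.op (LbM r (r + 1) (by omega) (by omega) (by omega) (by omega)
          (by omega)))
        (congrArg MulOpposite.op (LbM r (r + 2) (by omega) (by omega) (by omega) (by omega)
          (by omega)))
  exact ⟨hE.1, hE.2, hF.1, hF.2⟩
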